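/- Let Ω ⊂ ℝⁿ be a bounded John domain and {Q_t}_{t∈Γ} a Whitney decomposition of Ω. Then there exist a constant K > 1 and a tree structure on Γ with some root a ∈ Γ such that Q_s ⊆ K Q_t for all s, t ∈ Γ with s ⪰ t; in other words, the shadow of Q_t is contained in the K-fold dilate of Q_t about its center. -/

import Mathlib

open MeasureTheory Metric Set Matrix
open scoped BigOperators ENNReal

noncomputable section

abbrev Euc (n : ℕ) := EuclideanSpace ℝ (Fin n)

/-- Differential matrix `(Dv)_{ij} = ∂v_i/∂x_j` (computed via the Fréchet derivative). -/
def Dmat {n : ℕ} (v : Euc n → Euc n) (x : Euc n) : Matrix (Fin n) (Fin n) ℝ :=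
  fun i j => fderiv ℝ v x (EuclideanSpace.single j 1) i

/-- Symmetric part of the differential matrix. -/
def epsMat {n : ℕ} (v : Euc n → Euc n) (x : Euc n) : Matrix (Fin n) (Fin n) ℝ :=
  (1 / 2 : ℝ) • (Dmat v x + (Dmat v x)ᵀ)

/-- Trace-free part of the symmetric part of the differential matrix. -/
def lMat {n : ℕ} (v : Euc n → Euc n) (x : Euc n) : Matrix (Fin n) (Fin n) ℝ :=
  epsMat v x - (Matrix.trace (Dmat v x) / (n : ℝ)) • (1 : Matrix (Fin n) (Fin n) ℝ)

/-- Frobenius (Euclidean) norm of a matrix. -/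
def matNorm {n : ℕ} (M : Matrix (Fin n) (Fin n) ℝ) : ℝ :=
  Real.sqrt (∑ i, ∑ j, (M i j) ^ 2)

/-- `M : N = Σ_{ij} M_{ij} N_{ij}`. -/
def matDot {n : ℕ} (M N : Matrix (Fin n) (Fin n) ℝ) : ℝ := ∑ i, ∑ j, M i j * N i j

/-- Distance to the boundary of `Ω`. -/
def distBd {n : ℕ} (Ω : Set (Euc n)) (x : Euc n) : ℝ := Metric.infDist x (frontier Ω)

/-- Open axis-parallel cube with center `c` and side length `h`. -/
def openCube {n : ℕ} (c : Euc n) (h : ℝ) : Set (Euc n) := {x | ∀ i, |x i - c i| < h / 2}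

/-- Closed axis-parallel cube with center `c` and side length `h`. -/
def closedCube {n : ℕ} (c : Euc n) (h : ℝ) : Set (Euc n) := {x | ∀ i, |x i - c i| ≤ h / 2}

/-- Bounded John domain: there are `C > 1` and a distinguished point `x₀ ∈ Ω` such that
every point of `Ω` is joined to `x₀` by a rectifiable curve, parameterized by arc length
(hence 1-Lipschitz), along which the distance to the boundary grows linearly. -/
def IsJohnDomain {n : ℕ} (Ω : Set (Euc n)) : Prop :=
  ∃ C > (1 : ℝ), ∃ x₀ ∈ Ω, ∀ y ∈ Ω, ∃ L : ℝ, 0 ≤ L ∧ ∃ γ : ℝ → Euc n,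
    γ 0 = y ∧ γ L = x₀ ∧ (∀ t ∈ Icc 0 L, γ t ∈ Ω) ∧
    (∀ s ∈ Icc 0 L, ∀ t ∈ Icc 0 L, dist (γ s) (γ t) ≤ |s - t|) ∧
    (∀ t ∈ Icc 0 L, t / C ≤ Metric.infDist (γ t) (frontier Ω))

/-- The matrix-valued functions `H_i`. -/
def Hmat {n : ℕ} (i : Fin n) (z : Euc n) : Matrix (Fin n) (Fin n) ℝ :=
  fun j k => if j = k then z i else if k = i then z j else if j = i then -z k else 0

/-- The finite-dimensional space `V = D(Σ)`:
`φ(x) = A + λ I + Σ_i b_i H_i(x − y)` with `A` skew-symmetric. -/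
def Vset (n : ℕ) : Set (Euc n → Matrix (Fin n) (Fin n) ℝ) :=
  {φ | ∃ (A : Matrix (Fin n) (Fin n) ℝ) (lam : ℝ) (b : Fin n → ℝ) (y : Euc n),
    Aᵀ = -A ∧ ∀ x, φ x = A + lam • (1 : Matrix (Fin n) (Fin n) ℝ) + ∑ i, b i • Hmat i (x - y)}


/-- A Whitney decomposition of `Ω`: closed dyadic axis-parallel cubes `Q_t` with pairwise
disjoint interiors covering `Ω`, with `diam(Q_t) ≤ dist(Q_t, ∂Ω) ≤ 4 diam(Q_t)` and
comparable diameters (within a factor 4) for touching cubes. -/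
structure WhitneyDecomp (n : ℕ) (Ω : Set (Euc n)) (Γ : Type) where
  c : Γ → Euc n
  s : Γ → ℝ
  s_pos : ∀ t, 0 < s t
  dyadic : ∀ t, ∃ k : ℤ, s t = (2 : ℝ) ^ k ∧
    ∀ i, ∃ m : ℤ, c t i = (m : ℝ) * (2 : ℝ) ^ k + (2 : ℝ) ^ k / 2
  interior_disj : Pairwise fun t t' =>
    interior (closedCube (c t) (s t)) ∩ interior (closedCube (c t') (s t')) = ∅
  cover : (⋃ t, closedCube (c t) (s t)) = Ω
  diam_le_dist : ∀ t, ∀ x ∈ closedCube (c t) (s t),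
    Metric.diam (closedCube (c t) (s t)) ≤ Metric.infDist x (frontier Ω)
  dist_le_diam : ∀ t, ∃ x ∈ closedCube (c t) (s t),
    Metric.infDist x (frontier Ω) ≤ 4 * Metric.diam (closedCube (c t) (s t))
  nbr_comparable : ∀ t t', (closedCube (c t) (s t) ∩ closedCube (c t') (s t')).Nonempty →
    Metric.diam (closedCube (c t) (s t)) ≤ 4 * Metric.diam (closedCube (c t') (s t'))

/-- The extended (open) Whitney cube `Ω_t = (9/8) Q_t°`. -/
def extCube {n : ℕ} {Ω : Set (Euc n)} {Γ : Type} (wd : WhitneyDecomp n Ω Γ) (t : Γ) :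
    Set (Euc n) :=
  openCube (wd.c t) (9 / 8 * wd.s t)

/-- A closed `(n−1)`-dimensional face of the cube with center `c` and side `h`. -/
def cubeFace {n : ℕ} (c : Euc n) (h : ℝ) (i : Fin n) (σ : Bool) : Set (Euc n) :=
  {x ∈ closedCube c h | x i = c i + (if σ then h / 2 else -(h / 2))}

/-- Two axis-parallel cubes are `(n−1)`-neighbors when their intersection is an
`(n−1)`-dimensional face of one of them. -/
def IsFaceNeighbor {n : ℕ} (c₁ : Euc n) (h₁ : ℝ) (c₂ : Euc n) (h₂ : ℝ) : Prop :=
  ∃ i σ, closedCube c₁ h₁ ∩ closedCube c₂ h₂ = cubeFace c₁ h₁ i σ ∨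
    closedCube c₁ h₁ ∩ closedCube c₂ h₂ = cubeFace c₂ h₂ i σ

/-- A tree structure on the index set `Γ` of a Whitney decomposition: a root and a parent
map reaching the root in finitely many steps, whose edges join `(n−1)`-neighbor cubes. -/
structure TreeStruct {n : ℕ} {Ω : Set (Euc n)} {Γ : Type} (wd : WhitneyDecomp n Ω Γ) where
  root : Γ
  parent : Γ → Γ
  parent_root : parent root = root
  reaches_root : ∀ t, ∃ k : ℕ, parent^[k] t = root
  parent_nbr : ∀ t, t ≠ root →
    IsFaceNeighbor (wd.c t) (wd.s t) (wd.c (parent t)) (wd.s (parent t))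

/-- The induced partial order: `s ⪯ t` iff the path from `t` to the root passes
through `s`, i.e. `s` is obtained from `t` by iterating the parent map. -/
def treeLE {n : ℕ} {Ω : Set (Euc n)} {Γ : Type} {wd : WhitneyDecomp n Ω Γ}
    (T : TreeStruct wd) (s t : Γ) : Prop :=
  ∃ k : ℕ, T.parent^[k] t = s

/-- The shadow `W_t = ⋃_{s ⪰ t} Ω_s` of the extended cube `Ω_t`. -/
def shadow {n : ℕ} {Ω : Set (Euc n)} {Γ : Type} {wd : WhitneyDecomp n Ω Γ}
    (T : TreeStruct wd) (t : Γ) : Set (Euc n) :=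
  ⋃ (s : Γ) (_ : treeLE T t s), extCube wd s

open Classical in
/-- The Hardy type operator `Tg(x) = Σ_{t ≠ a} (χ_{B_t}(x)/|W_t|) ∫_{W_t} |g|`, for a
family of cubes `B_t = openCube (Bc t) (Bh t)`. -/
def hardyT {n : ℕ} {Ω : Set (Euc n)} {Γ : Type} {wd : WhitneyDecomp n Ω Γ}
    (T : TreeStruct wd) (Bc : Γ → Euc n) (Bh : Γ → ℝ) (u : Euc n → ℝ) (x : Euc n) : ℝ :=
  ∑ᶠ t : Γ, if t = T.root then 0 else
    Set.indicator (openCube (Bc t) (Bh t))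
      (fun _ => (∫ y in shadow T t, |u y|) / (volume (shadow T t)).toReal) x

/-! ### Dyadic intervals -/

lemma exists_int_mul_zpow {m k : ℤ} (hmk : m ≤ k) (M : ℤ) :
    ∃ z : ℤ, (M : ℝ) * 2 ^ k = z * 2 ^ m := by
  obtain ⟨a, rfl⟩ := Int.le.dest hmk
  refine ⟨M * 2 ^ a, ?_⟩
  rw [zpow_add₀ (by norm_num)]
  push_cast
  rw [zpow_natCast]
  ring

/-- The center of a dyadic interval of length `2 ^ m` cannot lie on the left of a multiple of
`2 ^ k`, `m ≤ k`, without the whole interval doing so. -/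
lemma cell_le_of_center_le {m k M z : ℤ} (hmk : m ≤ k)
    (h : ((z : ℝ) + 1 / 2) * 2 ^ m ≤ M * 2 ^ k) : ((z : ℝ) + 1) * 2 ^ m ≤ M * 2 ^ k := by
  obtain ⟨a, ha⟩ := exists_int_mul_zpow hmk M
  have hm : (0 : ℝ) < 2 ^ m := by positivity
  rw [ha] at h ⊢
  have h1 : (z : ℝ) + 1 / 2 ≤ a := le_of_mul_le_mul_right h hm
  have h2 : z < a := by
    have : (z : ℝ) < a := by linarith
    exact_mod_cast this
  have h3 : (z : ℝ) + 1 ≤ a := by exact_mod_cast h2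
  gcongr

lemma le_cell_of_le_center {m k M z : ℤ} (hmk : m ≤ k)
    (h : (M : ℝ) * 2 ^ k ≤ ((z : ℝ) + 1 / 2) * 2 ^ m) : (M : ℝ) * 2 ^ k ≤ z * 2 ^ m := by
  obtain ⟨a, ha⟩ := exists_int_mul_zpow hmk M
  have hm : (0 : ℝ) < 2 ^ m := by positivity
  rw [ha] at h ⊢
  have h1 : (a : ℝ) ≤ (z : ℝ) + 1 / 2 := le_of_mul_le_mul_right h hm
  have h2 : a < z + 1 := by
    have : (a : ℝ) < z + 1 := by linarith
    exact_mod_cast this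
  have h3 : (a : ℝ) ≤ z := by exact_mod_cast Int.lt_add_one_iff.mp h2
  gcongr

/-- `[c - s/2, c + s/2]` is a dyadic interval of length at least `2 ^ m`. -/
def IsDyadicInterval (m : ℤ) (c s : ℝ) : Prop :=
  ∃ k M : ℤ, m ≤ k ∧ s = 2 ^ k ∧ c = (M : ℝ) * 2 ^ k + 2 ^ k / 2

/-- The center of the `z`-th dyadic interval of length `2 ^ m`. -/
def cellMid (m z : ℤ) : ℝ := ((z : ℝ) + 1 / 2) * 2 ^ m

lemma IsDyadicInterval.cell_subset {m z : ℤ} {c s : ℝ} (hI : IsDyadicInterval m c s)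
    (hz : |cellMid m z - c| ≤ s / 2) :
    c - s / 2 ≤ cellMid m z - 2 ^ m / 2 ∧ cellMid m z + 2 ^ m / 2 ≤ c + s / 2 := by
  obtain ⟨k, M, hmk, rfl, rfl⟩ := hI
  rw [cellMid, abs_le] at hz
  have h1 := le_cell_of_le_center (z := z) (M := M) hmk (by linarith)
  have h2 := cell_le_of_center_le (z := z) (M := M + 1) hmk (by push_cast; linarith)
  push_cast at h2
  unfold cellMid
  constructor <;> linarith

/-- Two dyadic intervals sharing a dyadic cell are nested. -/
lemma IsDyadicInterval.nested {m z : ℤ} {c s c' s' : ℝ} (hI : IsDyadicInterval m c s)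
    (hI' : IsDyadicInterval m c' s') (hs : s ≤ s') (hz : |cellMid m z - c| ≤ s / 2)
    (hz' : |cellMid m z - c'| ≤ s' / 2) : c' - s' / 2 ≤ c - s / 2 ∧ c + s / 2 ≤ c' + s' / 2 := by
  have h1 := hI.cell_subset hz
  have hm : (0 : ℝ) < 2 ^ m := by positivity
  obtain ⟨k, M, hmk, rfl, rfl⟩ := hI
  obtain ⟨k', M', hmk', rfl, rfl⟩ := hI'
  have hkk : k ≤ k' := (zpow_le_zpow_iff_right₀ (by norm_num : (1 : ℝ) < 2)).mp hs
  have hk : (0 : ℝ) < 2 ^ k := by positivity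
  obtain ⟨a, ha⟩ := exists_int_mul_zpow hkk M'
  obtain ⟨b, hb⟩ := exists_int_mul_zpow hkk (M' + 1)
  push_cast at hb
  rw [abs_le] at hz'
  have h2 : a < M + 1 := by
    have : (a : ℝ) * 2 ^ k < (M + 1) * 2 ^ k := by linarith
    exact_mod_cast lt_of_mul_lt_mul_right this hk.le
  have h3 : M < b := by
    have : (M : ℝ) * 2 ^ k < b * 2 ^ k := by linarith
    exact_mod_cast lt_of_mul_lt_mul_right this hk.le
  have h4 : (a : ℝ) * 2 ^ k ≤ M * 2 ^ k := by
    have : (a : ℝ) ≤ M := by exact_mod_cast Int.lt_add_one_iff.mp h2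
    gcongr
  have h5 : ((M : ℝ) + 1) * 2 ^ k ≤ b * 2 ^ k := by
    have : (M : ℝ) + 1 ≤ b := by exact_mod_cast h3
    gcongr
  constructor <;> linarith

/-- If consecutive dyadic cells lie in two dyadic intervals, then these intervals are nested or
touch at the common endpoint of the cells. -/
lemma IsDyadicInterval.nested_or_touch {m z z' : ℤ} {c s c' s' : ℝ} (hI : IsDyadicInterval m c s)
    (hI' : IsDyadicInterval m c' s') (hs : s ≤ s') (hzz : z' = z + 1 ∨ z = z' + 1)
    (hz : |cellMid m z - c| ≤ s / 2) (hz' : |cellMid m z' - c'| ≤ s' / 2) :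
    (c' - s' / 2 ≤ c - s / 2 ∧ c + s / 2 ≤ c' + s' / 2) ∨ c + s / 2 = c' - s' / 2 ∨
      c - s / 2 = c' + s' / 2 := by
  have hm : (0 : ℝ) < 2 ^ m := by positivity
  by_cases h : |cellMid m z - c'| ≤ s' / 2
  · exact Or.inl (hI.nested hI' hs hz h)
  by_cases h' : |cellMid m z' - c| ≤ s / 2
  · exact Or.inl (hI.nested hI' hs h' hz')
  right
  have h1 := hI.cell_subset hz
  have h2 := hI'.cell_subset hz'
  obtain ⟨k, M, hmk, rfl, rfl⟩ := hI
  obtain ⟨k', M', hmk', rfl, rfl⟩ := hI'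
  rw [abs_le, not_and_or, not_le, not_le] at h h'
  unfold cellMid at *
  rcases hzz with rfl | rfl
  · left
    push_cast at *
    have h3 : ((M + 1 : ℤ) : ℝ) * 2 ^ k ≤ ((z : ℝ) + 1) * 2 ^ m := by
      have := le_cell_of_le_center (M := M + 1) (z := z + 1) hmk (by
        push_cast
        rcases h' with h' | h' <;> linarith)
      push_cast at this ⊢
      exact this
    have h4 := cell_le_of_center_le (M := M') (z := z) hmk' (by rcases h with h | h <;> linarith)
    push_cast at h3
    linarith
  · right
    push_cast at *
    have h3 := cell_le_of_center_le (M := M) (z := z') hmk (by rcases h' with h' | h' <;> linarith)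
    have h4 := le_cell_of_le_center (M := M' + 1) (z := z' + 1) hmk' (by
        push_cast
        rcases h with h | h <;> linarith)
    push_cast at h4
    linarith

/-! ### Cubes -/

section Cubes

variable {n : ℕ} {c c' : Euc n} {h h' : ℝ}

lemma isOpen_openCube : IsOpen (openCube c h) := by
  simp only [openCube, Set.ofPred_forall]
  exact isOpen_iInter_of_finite fun i => isOpen_lt (by fun_prop) continuous_const

lemma openCube_subset_closedCube : openCube c h ⊆ closedCube c h := fun _ hx i => (hx i).le

lemma center_mem_closedCube (hh : 0 < h) : c ∈ closedCube c h := fun i => by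
  simpa using (half_pos hh).le

lemma norm_le_of_coord_le {x : Euc n} {δ : ℝ} (hx : ∀ i, |x i| ≤ δ) : ‖x‖ ≤ n * δ := by
  rw [EuclideanSpace.norm_eq]
  calc √(∑ i, ‖x i‖ ^ 2) ≤ ∑ i, ‖x i‖ := by
        rw [Real.sqrt_le_left (by positivity)]
        exact Finset.sum_sq_le_sq_sum_of_nonneg fun i _ => norm_nonneg _
    _ ≤ ∑ _i : Fin n, δ := Finset.sum_le_sum fun i _ => hx i
    _ = n * δ := by simp

lemma dist_le_of_coord_le {x y : Euc n} {δ : ℝ} (hxy : ∀ i, |x i - y i| ≤ δ) :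
    dist x y ≤ n * δ := by
  rw [dist_eq_norm]
  exact norm_le_of_coord_le hxy

lemma coord_le_dist (x y : Euc n) (i : Fin n) : |x i - y i| ≤ dist x y := by
  rw [dist_eq_norm]
  exact PiLp.norm_apply_le (x - y) i

lemma dist_le_of_mem_closedCube {x y : Euc n} (hx : x ∈ closedCube c h) (hy : y ∈ closedCube c h) :
    dist x y ≤ n * h :=
  dist_le_of_coord_le fun i => by
    have h1 := abs_le.mp (hx i)
    have h2 := abs_le.mp (hy i)
    rw [abs_le]
    constructor <;> linarith

lemma diam_closedCube_le (hh : 0 < h) : diam (closedCube c h) ≤ n * h :=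
  Metric.diam_le_of_forall_dist_le (by positivity) fun _ hx _ hy => dist_le_of_mem_closedCube hx hy

lemma half_le_diam_of_closedCube_subset (hn : 0 < n) (hh : 0 < h) {U : Set (Euc n)}
    (hU : Bornology.IsBounded U) (hsub : closedCube c h ⊆ U) : h / 2 ≤ diam U := by
  have hmem : c + EuclideanSpace.single (⟨0, hn⟩ : Fin n) (h / 2) ∈ closedCube c h := fun i => by
    simp only [PiLp.add_apply, add_sub_cancel_left, PiLp.single_apply]
    split_ifs
    · rw [abs_of_pos (by positivity)]
    · simpa using (half_pos hh).le
  have := dist_le_diam_of_mem hU (hsub hmem) (hsub (center_mem_closedCube hh))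
  simpa [dist_eq_norm, abs_of_pos hh] using this

lemma IsFaceNeighbor.symm (H : IsFaceNeighbor c h c' h') : IsFaceNeighbor c' h' c h := by
  obtain ⟨i, σ, H⟩ := H
  exact ⟨i, σ, by rw [inter_comm]; exact H.symm⟩

lemma IsFaceNeighbor.nonempty_inter (hh : 0 < h) (hh' : 0 < h') (H : IsFaceNeighbor c h c' h') :
    (closedCube c h ∩ closedCube c' h').Nonempty := by
  have face : ∀ (d : Euc n) (l : ℝ), 0 < l → ∀ i σ, (cubeFace d l i σ).Nonempty := by
    intro d l hl i σ
    refine ⟨d + EuclideanSpace.single i (if σ then l / 2 else -(l / 2)), fun j => ?_, by simp⟩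
    simp only [PiLp.add_apply, add_sub_cancel_left, PiLp.single_apply]
    split_ifs
    · rw [abs_of_pos (by positivity)]
    · rw [abs_neg, abs_of_pos (by positivity)]
    · simpa using (half_pos hl).le
  obtain ⟨i, σ, H | H⟩ := H <;> rw [H]
  · exact face _ _ hh _ _
  · exact face _ _ hh' _ _

lemma IsFaceNeighbor.abs_sub_le (hh : 0 < h) (hh' : 0 < h') (H : IsFaceNeighbor c h c' h')
    (i : Fin n) : |c i - c' i| ≤ h / 2 + h' / 2 := by
  obtain ⟨x, hx, hx'⟩ := H.nonempty_inter hh hh'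
  have h1 := abs_le.mp (hx i)
  have h2 := abs_le.mp (hx' i)
  rw [abs_le]
  constructor <;> linarith

/-- Two cubes that touch in the direction `i` and such that the first is no larger than the second
in every other direction share a face of the first. -/
lemma isFaceNeighbor_of_touch (i : Fin n)
    (hj : ∀ j, j ≠ i → c' j - h' / 2 ≤ c j - h / 2 ∧ c j + h / 2 ≤ c' j + h' / 2)
    (hh' : 0 < h')
    (hi : c i + h / 2 = c' i - h' / 2 ∨ c i - h / 2 = c' i + h' / 2) :
    IsFaceNeighbor c h c' h' := by
  have key : ∀ e : ℝ, (∀ x : Euc n, x ∈ closedCube c h → x i = c i + e → |x i - c' i| ≤ h' / 2) →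
      (∀ x : Euc n, x ∈ closedCube c h → |x i - c' i| ≤ h' / 2 → x i = c i + e) →
      closedCube c h ∩ closedCube c' h' = {x ∈ closedCube c h | x i = c i + e} := by
    intro e h1 h2
    ext x
    refine ⟨fun hx => ⟨hx.1, h2 x hx.1 (hx.2 i)⟩, fun hx => ⟨hx.1, fun j => ?_⟩⟩
    by_cases hji : j = i
    · subst hji
      exact h1 x hx.1 hx.2
    · have := hj j hji
      have h3 := abs_le.mp (hx.1 j)
      rw [abs_le]
      constructor <;> linarith
  rcases hi with hi | hi
  · refine ⟨i, true, Or.inl (key _ (fun x _ hxi => ?_) fun x hx hxi => ?_)⟩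
    · simp only [if_true] at hxi
      rw [abs_le]
      constructor <;> linarith
    · have h3 := abs_le.mp (hx i)
      rw [abs_le] at hxi
      simp only [if_true]
      linarith
  · refine ⟨i, false, Or.inl (key _ (fun x _ hxi => ?_) fun x hx hxi => ?_)⟩
    · simp only [Bool.false_eq_true, if_false] at hxi
      rw [abs_le]
      constructor <;> linarith
    · have h3 := abs_le.mp (hx i)
      rw [abs_le] at hxi
      simp only [Bool.false_eq_true, if_false]
      linarith

end Cubes

/-! ### Chains of minimal weight in a graph -/

section Chains

variable {Γ : Type*} {r : Γ → Γ → Prop} {w : Γ → ℕ} {a : Γ}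

/-- `ChainWeight r w a t k`: some `r`-chain from `t` to `a` has total vertex weight `k`. -/
inductive ChainWeight (r : Γ → Γ → Prop) (w : Γ → ℕ) (a : Γ) : Γ → ℕ → Prop
  | base : ChainWeight r w a a (w a)
  | step {u t : Γ} {k : ℕ} : ChainWeight r w a u k → r t u → ChainWeight r w a t (k + w t)

/-- Some `r`-chain from `t` to `a` has total vertex weight at most `b`. -/
def ChainWeightLE (r : Γ → Γ → Prop) (w : Γ → ℕ) (a t : Γ) (b : ℝ) : Prop :=
  ∃ k, ChainWeight r w a t k ∧ (k : ℝ) ≤ b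

lemma ChainWeightLE.mono {t : Γ} {b b' : ℝ} (h : ChainWeightLE r w a t b) (hb : b ≤ b') :
    ChainWeightLE r w a t b' :=
  let ⟨k, hk, hkb⟩ := h
  ⟨k, hk, hkb.trans hb⟩

lemma ChainWeightLE.step {u t : Γ} {b W : ℝ} (h : ChainWeightLE r w a u b) (hr : r t u)
    (hW : (w t : ℝ) ≤ W) : ChainWeightLE r w a t (b + W) := by
  obtain ⟨k, hk, hkb⟩ := h
  exact ⟨k + w t, hk.step hr, by push_cast; linarith⟩

/-- Shortest-path tree for a vertex weight: `D` is the distance to the root `a`. -/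
lemma exists_shortest_path_tree (hreach : ∀ t, ∃ k, ChainWeight r w a t k) :
    ∃ (D : Γ → ℕ) (parent : Γ → Γ), parent a = a ∧ (∀ t, w t ≤ D t) ∧
      (∀ t, t ≠ a → r t (parent t) ∧ D (parent t) + w t ≤ D t) ∧
      ∀ t k, ChainWeight r w a t k → D t ≤ k := by
  classical
  let D : Γ → ℕ := fun t => sInf {k | ChainWeight r w a t k}
  have hD : ∀ t, ChainWeight r w a t (D t) := fun t => Nat.sInf_mem (hreach t)
  have hle : ∀ t k, ChainWeight r w a t k → D t ≤ k := fun t k hk => Nat.sInf_le hk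
  have hpar : ∀ t, ∃ u, t ≠ a → r t u ∧ D u + w t ≤ D t := by
    intro t
    have := hD t
    generalize D t = l at this
    cases this with
    | base => exact ⟨a, fun h => absurd rfl h⟩
    | step hu hr => exact ⟨_, fun _ => ⟨hr, Nat.add_le_add_right (hle _ _ hu) _⟩⟩
  choose p hp using hpar
  refine ⟨D, fun t => if t = a then a else p t, by simp, fun t => ?_, fun t ht => ?_, hle⟩
  · have := hD t
    generalize D t = l at this
    cases this with
    | base => exact le_rfl
    | step hu hr => exact Nat.le_add_left _ _
  · simpa [ht] using hp t ht

end Chains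

/-! ### Chains of Whitney cubes -/

lemma IsDyadicInterval.exists_cell {m : ℤ} {c s x : ℝ} (hI : IsDyadicInterval m c s)
    (hx : |x - c| ≤ s / 2) :
    ∃ z : ℤ, |cellMid m z - c| ≤ s / 2 ∧ |cellMid m z - x| ≤ 2 ^ m / 2 := by
  obtain ⟨k, M, hmk, rfl, rfl⟩ := hI
  obtain ⟨p, hp⟩ := exists_int_mul_zpow hmk M
  obtain ⟨q, hq⟩ := exists_int_mul_zpow hmk (M + 1)
  push_cast at hq
  have hm : (0 : ℝ) < 2 ^ m := by positivity
  have hk : (0 : ℝ) < 2 ^ k := by positivity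
  rw [abs_le] at hx
  have key : ∃ z : ℤ, p ≤ z ∧ z + 1 ≤ q ∧ (z : ℝ) * 2 ^ m ≤ x ∧ x ≤ (z + 1) * 2 ^ m := by
    have hpq : p + 1 ≤ q := by
      have : (p : ℝ) * 2 ^ m < q * 2 ^ m := by linarith
      exact_mod_cast lt_of_mul_lt_mul_right this hm.le
    rcases lt_or_ge x (q * 2 ^ m) with h | h
    · refine ⟨⌊x / 2 ^ m⌋, ?_, ?_, ?_, ?_⟩
      · rw [Int.le_floor, le_div_iff₀ hm]
        linarith
      · rw [Int.add_one_le_iff, Int.floor_lt, div_lt_iff₀ hm]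
        exact h
      · rw [← le_div_iff₀ hm]
        exact Int.floor_le _
      · rw [← div_le_iff₀ hm]
        exact (Int.lt_floor_add_one _).le
    · refine ⟨q - 1, by linarith, by linarith, ?_, ?_⟩ <;> push_cast <;> linarith
  obtain ⟨z, h1, h2, h3, h4⟩ := key
  have h1' : (p : ℝ) * 2 ^ m ≤ z * 2 ^ m := by
    have : (p : ℝ) ≤ z := by exact_mod_cast h1
    gcongr
  have h2' : ((z : ℝ) + 1) * 2 ^ m ≤ q * 2 ^ m := by
    have : (z : ℝ) + 1 ≤ q := by exact_mod_cast h2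
    gcongr
  refine ⟨z, ?_, ?_⟩ <;> rw [abs_le, cellMid] <;> constructor <;> linarith

lemma cellMid_mono {m z z' : ℤ} (h : z ≤ z') : cellMid m z ≤ cellMid m z' := by
  have : (z : ℝ) ≤ z' := by exact_mod_cast h
  unfold cellMid
  gcongr

/-- The center of the dyadic cube of side `2 ^ m` with index `z`. -/
def cellCenter {n : ℕ} (m : ℤ) (z : Fin n → ℤ) : Euc n := WithLp.toLp 2 fun i => cellMid m (z i)

namespace WhitneyDecomp

variable {n : ℕ} {Ω : Set (Euc n)} {Γ : Type} (wd : WhitneyDecomp n Ω Γ)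

/-- The Whitney cube `Q_t`. -/
abbrev cube (t : Γ) : Set (Euc n) := closedCube (wd.c t) (wd.s t)

/-- The neighbor relation of the graph `G_Γ`. -/
abbrev nbr (t u : Γ) : Prop := IsFaceNeighbor (wd.c t) (wd.s t) (wd.c u) (wd.s u)

variable {wd}

lemma cube_subset (t : Γ) : wd.cube t ⊆ Ω := by
  conv_rhs => rw [← wd.cover]
  exact subset_iUnion wd.cube t

lemma exists_mem_cube {x : Euc n} (hx : x ∈ Ω) : ∃ t, x ∈ wd.cube t := by
  rw [← wd.cover] at hx
  exact mem_iUnion.mp hx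

lemma isDyadicInterval {m : ℤ} {t : Γ} (hm : 2 ^ m ≤ wd.s t) (i : Fin n) :
    IsDyadicInterval m (wd.c t i) (wd.s t) := by
  obtain ⟨k, hk, hc⟩ := wd.dyadic t
  obtain ⟨M, hM⟩ := hc i
  rw [hk] at hm
  exact ⟨k, M, (zpow_le_zpow_iff_right₀ (by norm_num : (1 : ℝ) < 2)).mp hm, hk, hM⟩

lemma eq_of_nested {t u : Γ} (h : ∀ i, wd.c u i - wd.s u / 2 ≤ wd.c t i - wd.s t / 2 ∧
    wd.c t i + wd.s t / 2 ≤ wd.c u i + wd.s u / 2) : t = u := by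
  by_contra hne
  have hsub : openCube (wd.c t) (wd.s t) ⊆ closedCube (wd.c u) (wd.s u) := fun x hx i => by
    have h1 := abs_lt.mp (hx i)
    have h2 := h i
    rw [abs_le]
    constructor <;> linarith
  have hc : wd.c t ∈ openCube (wd.c t) (wd.s t) := fun i => by simpa using wd.s_pos t
  have : wd.c t ∈ interior (wd.cube t) ∩ interior (wd.cube u) :=
    ⟨interior_maximal openCube_subset_closedCube isOpen_openCube hc,
      interior_maximal hsub isOpen_openCube hc⟩
  rw [wd.interior_disj hne] at this
  exact this

lemma eq_of_cellCenter_mem {m : ℤ} {t u : Γ} {z : Fin n → ℤ} (ht : 2 ^ m ≤ wd.s t)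
    (hu : 2 ^ m ≤ wd.s u) (hzt : cellCenter m z ∈ wd.cube t) (hzu : cellCenter m z ∈ wd.cube u) :
    t = u := by
  wlog hs : wd.s t ≤ wd.s u generalizing t u
  · exact (this hu ht hzu hzt (not_le.mp hs).le).symm
  exact eq_of_nested fun i =>
    (isDyadicInterval ht i).nested (isDyadicInterval hu i) hs (hzt i) (hzu i)

/-- Whitney cubes containing adjacent dyadic cells coincide or are neighbors. -/
lemma eq_or_nbr_of_cell_adjacent {m : ℤ} {t u : Γ} {z z' : Fin n → ℤ} {i : Fin n}
    (ht : 2 ^ m ≤ wd.s t) (hu : 2 ^ m ≤ wd.s u) (hzt : cellCenter m z ∈ wd.cube t)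
    (hzu : cellCenter m z' ∈ wd.cube u) (hj : ∀ j, j ≠ i → z j = z' j)
    (hi : z' i = z i + 1 ∨ z i = z' i + 1) : t = u ∨ wd.nbr t u := by
  wlog hs : wd.s t ≤ wd.s u generalizing t u z z'
  · have := this hu ht hzu hzt (fun j h => (hj j h).symm) hi.symm (not_le.mp hs).le
    exact this.imp Eq.symm IsFaceNeighbor.symm
  have hnest : ∀ j, j ≠ i → wd.c u j - wd.s u / 2 ≤ wd.c t j - wd.s t / 2 ∧
      wd.c t j + wd.s t / 2 ≤ wd.c u j + wd.s u / 2 := fun j h =>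
    (isDyadicInterval ht j).nested (isDyadicInterval hu j) hs (hzt j) (by rw [hj j h]; exact hzu j)
  rcases (isDyadicInterval ht i).nested_or_touch (isDyadicInterval hu i) hs hi (hzt i) (hzu i)
    with h | h
  · left
    refine eq_of_nested (wd := wd) fun j => ?_
    by_cases hji : j = i
    · rw [hji]; exact h
    · exact hnest j hji
  · exact Or.inr (isFaceNeighbor_of_touch i hnest (wd.s_pos u) h)

/-- Walking through dyadic cells in a box on which all Whitney cubes are large and of weight
at most `W`. -/
lemma chainWeightLE_of_cell_walk {w : Γ → ℕ} {a : Γ} {m : ℤ} {x : Euc n} {δ W : ℝ} (hW : 0 ≤ W)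
    (hbox : ∀ y : Euc n, (∀ i, |y i - x i| ≤ δ) →
      y ∈ Ω ∧ ∀ t, y ∈ wd.cube t → 2 ^ m ≤ wd.s t ∧ (w t : ℝ) ≤ W)
    (N : ℕ) {z z' : Fin n → ℤ} (hz : ∀ i, |cellMid m (z i) - x i| ≤ δ)
    (hz' : ∀ i, |cellMid m (z' i) - x i| ≤ δ) (hN : ∑ i, (z i - z' i).natAbs ≤ N)
    {u v : Γ} (hu : cellCenter m z ∈ wd.cube u) (hv : cellCenter m z' ∈ wd.cube v) {b : ℝ}
    (hb : ChainWeightLE wd.nbr w a u b) : ChainWeightLE wd.nbr w a v (b + N * W) := by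
  have hdone : ∀ (N : ℕ) (b : ℝ) {z : Fin n → ℤ} {u : Γ}, (∀ i, |cellMid m (z i) - x i| ≤ δ) →
      cellCenter m z ∈ wd.cube u → z = z' → ChainWeightLE wd.nbr w a u b →
      ChainWeightLE wd.nbr w a v (b + N * W) := by
    rintro N b z u hz hu rfl hb
    rw [← eq_of_cellCenter_mem ((hbox _ hz).2 u hu).1 ((hbox _ hz).2 v hv).1 hu hv]
    exact hb.mono (le_add_of_nonneg_right (by positivity))
  induction N generalizing z u b with
  | zero =>
    refine hdone 0 b hz hu ?_ hb
    funext i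
    have := (Finset.sum_eq_zero_iff.mp (Nat.le_zero.mp hN)) i (Finset.mem_univ i)
    omega
  | succ N ih =>
    by_cases hzz : z = z'
    · exact hdone _ b hz hu hzz hb
    obtain ⟨i, hi⟩ := Function.ne_iff.mp hzz
    set y : Fin n → ℤ := Function.update z i (if z i < z' i then z i + 1 else z i - 1) with hy
    have hyi : y i = if z i < z' i then z i + 1 else z i - 1 := by simp [hy]
    have hyj : ∀ j, j ≠ i → y j = z j := fun j h => by simp [hy, h]
    have hybox : ∀ j, |cellMid m (y j) - x j| ≤ δ := by
      intro j
      by_cases hji : j = i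
      · subst hji
        have h1 := abs_le.mp (hz j)
        have h2 := abs_le.mp (hz' j)
        rw [abs_le, hyi]
        split_ifs with h
        · have h3 := cellMid_mono (m := m) (show z j ≤ z j + 1 by omega)
          have h4 := cellMid_mono (m := m) (show z j + 1 ≤ z' j by omega)
          constructor <;> linarith
        · have h3 := cellMid_mono (m := m) (show z j - 1 ≤ z j by omega)
          have h4 := cellMid_mono (m := m) (show z' j ≤ z j - 1 by omega)
          constructor <;> linarith
      · rw [hyj j hji]
        exact hz j
    have hsum : ∑ j, (y j - z' j).natAbs < ∑ j, (z j - z' j).natAbs := by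
      refine Finset.sum_lt_sum (fun j _ => ?_) ⟨i, Finset.mem_univ i, ?_⟩
      · by_cases hji : j = i
        · subst hji
          rw [hyi]
          split_ifs <;> omega
        · rw [hyj j hji]
      · rw [hyi]
        split_ifs <;> omega
    obtain ⟨t, ht⟩ := exists_mem_cube (wd := wd) (hbox (cellCenter m y) hybox).1
    obtain ⟨hts, htW⟩ := (hbox _ hybox).2 t ht
    have hcost : ChainWeightLE wd.nbr w a t (b + W) := by
      rcases eq_or_nbr_of_cell_adjacent hts ((hbox _ hz).2 u hu).1 ht hu hyj
        (by rw [hyi]; split_ifs <;> omega) with rfl | h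
      · exact hb.mono (by linarith)
      · exact hb.step h htW
    refine (ih hybox (by omega) ht hcost).mono ?_
    push_cast
    linarith


lemma half_side_le_infDist (hn : 0 < n) {t : Γ} {x : Euc n} (hx : x ∈ wd.cube t) :
    wd.s t / 2 ≤ infDist x (frontier Ω) := by
  refine le_trans ?_ (wd.diam_le_dist t x hx)
  exact half_le_diam_of_closedCube_subset hn (wd.s_pos t)
    (Metric.isBounded_iff.mpr ⟨_, fun _ hx _ hy => dist_le_of_mem_closedCube hx hy⟩) le_rfl

lemma infDist_le_side {t : Γ} {x : Euc n} (hx : x ∈ wd.cube t) :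
    infDist x (frontier Ω) ≤ 5 * (n * wd.s t) := by
  obtain ⟨y, hy, hyd⟩ := wd.dist_le_diam t
  have h1 := infDist_le_infDist_add_dist (x := x) (y := y) (s := frontier Ω)
  have h2 := dist_le_of_mem_closedCube hx hy
  have h3 := diam_closedCube_le (c := wd.c t) (wd.s_pos t)
  linarith

/-- The weight `⌈1 / ℓ⌉` of a cube of side `ℓ`. -/
def weight (wd : WhitneyDecomp n Ω Γ) (t : Γ) : ℕ := ⌈1 / wd.s t⌉₊

lemma inv_le_weight (t : Γ) : 1 / wd.s t ≤ wd.weight t := Nat.le_ceil _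

lemma weight_le {S : ℝ} {t : Γ} (hS : wd.s t ≤ S) : (wd.weight t : ℝ) ≤ (1 + S) / wd.s t := by
  have hs := wd.s_pos t
  refine (Nat.ceil_lt_add_one (by positivity)).le.trans ?_
  rw [add_div]
  gcongr
  rwa [one_le_div hs]

end WhitneyDecomp

lemma mem_of_dist_lt_infDist_frontier {n : ℕ} {Ω : Set (Euc n)} (hΩo : IsOpen Ω) {x y : Euc n}
    (hx : x ∈ Ω) (hy : dist x y < infDist x (frontier Ω)) : y ∈ Ω := by
  have hb : ball x (infDist x (frontier Ω)) ⊆ Ω ∪ (closure Ω)ᶜ := by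
    refine ball_infDist_subset_compl.trans fun z hz => ?_
    rw [hΩo.frontier_eq] at hz
    by_cases h : z ∈ Ω
    · exact Or.inl h
    · exact Or.inr fun h' => hz ⟨h', h⟩
  have hpre : IsPreconnected (ball x (infDist x (frontier Ω))) :=
    (convex_ball _ _).isPreconnected
  refine hpre.subset_left_of_subset_union hΩo isClosed_closure.isOpen_compl
    (disjoint_compl_right.mono_left subset_closure) hb
    ⟨x, mem_ball_self (dist_nonneg.trans_lt hy), hx⟩ ?_
  rwa [mem_ball, dist_comm]

namespace WhitneyDecomp

variable {n : ℕ} {Ω : Set (Euc n)} {Γ : Type} {wd : WhitneyDecomp n Ω Γ} {a : Γ} {S : ℝ}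

/-- Moving by a small fraction of the distance to the boundary changes the minimal weight of a
chain to the root by a controlled amount. -/
lemma chainWeightLE_of_dist_le (hn : 0 < n) (hΩo : IsOpen Ω) (hS : ∀ t, wd.s t ≤ S)
    {x y : Euc n} {u v : Γ} (hx : x ∈ wd.cube v) (hy : y ∈ wd.cube u)
    (hxy : dist x y ≤ infDist x (frontier Ω) / (20 * n)) {b : ℝ}
    (hb : ChainWeightLE wd.nbr wd.weight a u b) :
    ChainWeightLE wd.nbr wd.weight a v
      (b + 10 * n ^ 2 * (1 + S) / infDist x (frontier Ω)) := by
  have hxΩ : x ∈ Ω := cube_subset v hx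
  have hd : 0 < infDist x (frontier Ω) :=
    (half_pos (wd.s_pos v)).trans_le (half_side_le_infDist hn hx)
  set d := infDist x (frontier Ω) with hd_def
  have hn' : (0 : ℝ) < n := by exact_mod_cast hn
  have hS0 : 0 < S := (wd.s_pos v).trans_le (hS v)
  obtain ⟨m, hm1, hm2⟩ := exists_mem_Ico_zpow (show 0 < d / (10 * n) by positivity)
    (by norm_num : (1 : ℝ) < 2)
  rw [zpow_add_one₀ (by norm_num)] at hm2
  have hm : (0 : ℝ) < 2 ^ m := by positivity
  have hhalf : d / (20 * n) = d / (10 * n) / 2 := by ring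
  have hbox : ∀ p : Euc n, (∀ i, |p i - x i| ≤ d / (20 * n) + 2 ^ m) →
      p ∈ Ω ∧ ∀ t, p ∈ wd.cube t → 2 ^ m ≤ wd.s t ∧
        (wd.weight t : ℝ) ≤ (1 + S) / (d / (10 * n)) := by
    intro p hp
    have hpd : dist p x ≤ d / 2 := by
      refine (dist_le_of_coord_le hp).trans ?_
      calc (n : ℝ) * (d / (20 * n) + 2 ^ m) ≤ n * (d / (20 * n) + d / (10 * n)) := by gcongr
        _ = 3 * d / 20 := by field_simp; norm_num
        _ ≤ d / 2 := by linarith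
    refine ⟨mem_of_dist_lt_infDist_frontier hΩo hxΩ (by rw [dist_comm]; linarith), fun t ht => ?_⟩
    have h1 := infDist_le_infDist_add_dist (x := x) (y := p) (s := frontier Ω)
    have h2 := infDist_le_side ht
    rw [dist_comm] at h1
    have h3 : d / (10 * n) ≤ wd.s t := by
      rw [div_le_iff₀ (by positivity)]
      linarith
    exact ⟨hm1.trans h3, (weight_le (hS t)).trans (by gcongr)⟩
  have hv := ((hbox x fun i => by rw [sub_self, abs_zero]; positivity).2 v hx).1
  have hyx : ∀ i, |y i - x i| ≤ d / (20 * n) := fun i =>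
    (coord_le_dist y x i).trans (by rwa [dist_comm])
  have hu := ((hbox y fun i => (hyx i).trans (by linarith)).2 u hy).1
  choose zx hzx hzx' using fun i => (isDyadicInterval hv i).exists_cell (hx i)
  choose zy hzy hzy' using fun i => (isDyadicInterval hu i).exists_cell (hy i)
  have hsum : ∑ i, (zy i - zx i).natAbs ≤ n := by
    refine (Finset.sum_le_card_nsmul _ _ 1 fun i _ => ?_).trans (by simp)
    have h1 := abs_le.mp (hzx' i)
    have h2 := abs_le.mp (hzy' i)
    have h3 := abs_le.mp (hyx i)
    unfold cellMid at h1 h2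
    have h4 : zy i - zx i < 2 := by
      have : ((zy i - zx i : ℤ) : ℝ) * 2 ^ m < 2 * 2 ^ m := by push_cast; linarith
      exact_mod_cast lt_of_mul_lt_mul_right this hm.le
    have h5 : zx i - zy i < 2 := by
      have : ((zx i - zy i : ℤ) : ℝ) * 2 ^ m < 2 * 2 ^ m := by push_cast; linarith
      exact_mod_cast lt_of_mul_lt_mul_right this hm.le
    omega
  refine (chainWeightLE_of_cell_walk (by positivity) hbox n (z := zy) (z' := zx) (fun i => ?_)
    (fun i => (hzx' i).trans ?_) hsum hzy hzx hb).mono (le_of_eq ?_)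
  · have h1 := abs_le.mp (hzy' i)
    have h2 := abs_le.mp (hyx i)
    rw [abs_le]
    constructor <;> linarith
  · have : 0 < d / (20 * n) := by positivity
    linarith
  · field_simp

/-- Following a John curve: the minimal weight of a chain to the root is controlled by the inverse
of the distance to the boundary. -/
lemma chainWeightLE_of_john_curve (hn : 0 < n) (hΩo : IsOpen Ω) (hS : ∀ t, wd.s t ≤ S) {C : ℝ}
    (hC : 1 < C) {γ : ℝ → Euc n} {L D₀ : ℝ} (hL : 0 ≤ L) (hγΩ : ∀ τ ∈ Icc 0 L, γ τ ∈ Ω)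
    (hγ : ∀ σ ∈ Icc 0 L, ∀ τ ∈ Icc 0 L, dist (γ σ) (γ τ) ≤ |σ - τ|)
    (hJ : ∀ τ ∈ Icc 0 L, τ / C ≤ infDist (γ τ) (frontier Ω))
    (hD₀ : ∀ t, γ L ∈ wd.cube t → ChainWeightLE wd.nbr wd.weight a t D₀) {v : Γ}
    (hv : γ 0 ∈ wd.cube v) :
    ChainWeightLE wd.nbr wd.weight a v
      (D₀ + 30 * n ^ 2 * (1 + S) * C * (60 * n * C + 1) / infDist (γ 0) (frontier Ω)) := by
  have hd : 0 < infDist (γ 0) (frontier Ω) :=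
    (half_pos (wd.s_pos v)).trans_le (half_side_le_infDist hn hv)
  have hS0 : 0 < S := (wd.s_pos v).trans_le (hS v)
  set d := infDist (γ 0) (frontier Ω) with hd_def
  have hn' : (1 : ℝ) ≤ n := by exact_mod_cast hn
  set A := 30 * (n : ℝ) ^ 2 * (1 + S) * C with hA
  have hA0 : 0 < A := by positivity
  set p := 60 * (n : ℝ) * C with hp
  have hp0 : 0 < p := by positivity
  have hfar : ∀ τ ∈ Icc 0 L, (τ + d) / (3 * C) ≤ infDist (γ τ) (frontier Ω) := by
    intro τ hτ
    have h1 := infDist_le_infDist_add_dist (x := γ 0) (y := γ τ) (s := frontier Ω)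
    have h2 := hγ 0 ⟨le_rfl, hL⟩ τ hτ
    rw [zero_sub, abs_neg, abs_of_nonneg hτ.1] at h2
    have h3 := hJ τ hτ
    rw [div_le_iff₀ (by positivity)] at h3 ⊢
    have h4 : 0 ≤ infDist (γ τ) (frontier Ω) := infDist_nonneg
    by_cases h : τ ≤ d / 2
    · nlinarith
    · nlinarith
  have key : ∀ N : ℕ, ∀ τ ∈ Icc 0 L, L + d ≤ (τ + d) * (1 + 1 / p) ^ N → ∀ t, γ τ ∈ wd.cube t →
      ChainWeightLE wd.nbr wd.weight a t (D₀ + A * (p + 1) / (τ + d)) := by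
    intro N
    induction N with
    | zero =>
      intro τ hτ h t ht
      have hτL : τ = L := le_antisymm hτ.2 (by simpa using h)
      have : 0 < τ + d := by linarith [hτ.1]
      rw [hτL] at ht
      exact (hD₀ t ht).mono (le_add_of_nonneg_right (by positivity))
    | succ N ih =>
      intro τ hτ h t ht
      have hτd : 0 < τ + d := by linarith [hτ.1]
      have hstep : ∀ τ' ∈ Icc 0 L, τ ≤ τ' → τ' - τ ≤ (τ + d) / p → ∀ t', γ τ' ∈ wd.cube t' →
          ∀ b, ChainWeightLE wd.nbr wd.weight a t' b →
            ChainWeightLE wd.nbr wd.weight a t (b + A / (τ + d)) := by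
        intro τ' hτ' hττ' hle t' ht' b hb
        have hf := hfar τ hτ
        have h1 := hγ τ hτ τ' hτ'
        rw [abs_sub_comm, abs_of_nonneg (by linarith)] at h1
        refine (chainWeightLE_of_dist_le hn hΩo hS ht ht' (h1.trans (hle.trans ?_)) hb).mono ?_
        · calc (τ + d) / p = (τ + d) / (3 * C) / (20 * n) := by
                rw [hp, div_div]; congr 1; ring
            _ ≤ _ := by gcongr
        · have : A / (τ + d) = 10 * n ^ 2 * (1 + S) / ((τ + d) / (3 * C)) := by
            rw [hA]; field_simp; norm_num
          rw [this]
          gcongr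
      rcases le_or_gt L (τ + (τ + d) / p) with hcase | hcase
      · obtain ⟨t', ht'⟩ := exists_mem_cube (wd := wd) (hγΩ L ⟨hL, le_rfl⟩)
        refine (hstep L ⟨hL, le_rfl⟩ hτ.2 (by linarith) t' ht' _ (hD₀ t' ht')).mono ?_
        gcongr
        exact le_mul_of_one_le_right hA0.le (by linarith)
      · have hpos : 0 < (τ + d) / p := by positivity
        have hτ' : τ + (τ + d) / p ∈ Icc 0 L := ⟨by linarith [hτ.1], hcase.le⟩
        have hmul : τ + (τ + d) / p + d = (τ + d) * (1 + 1 / p) := by ring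
        obtain ⟨t', ht'⟩ := exists_mem_cube (wd := wd) (hγΩ _ hτ')
        refine (hstep _ hτ' (by linarith) (by linarith) t' ht' _ (ih _ hτ' ?_ t' ht')).mono
          (le_of_eq ?_)
        · rw [hmul, mul_assoc, ← pow_succ']
          exact h
        · rw [hmul]
          field_simp
          ring
  obtain ⟨N, hN⟩ := pow_unbounded_of_one_lt ((L + d) / d)
    (lt_add_of_pos_right (1 : ℝ) (by positivity : 0 < 1 / p))
  rw [div_lt_iff₀ hd] at hN
  have := key N 0 ⟨le_rfl, hL⟩ (by linarith) v hv
  rwa [zero_add] at this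

/-- In a John domain, every cube of side `ℓ` is joined to some fixed root by a chain of weight
at most a constant times `1 / ℓ`. -/
lemma exists_root_chainWeightLE (hn : 0 < n) (hΩo : IsOpen Ω) (hJ : IsJohnDomain Ω)
    (hS : ∀ t, wd.s t ≤ S) :
    ∃ (a : Γ) (M : ℝ), ∀ t, ChainWeightLE wd.nbr wd.weight a t (M / wd.s t) := by
  obtain ⟨C, hC, x₀, hx₀, hJ⟩ := hJ
  obtain ⟨a, ha⟩ := exists_mem_cube (wd := wd) hx₀
  have hS0 : 0 < S := (wd.s_pos a).trans_le (hS a)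
  have hd₀ : 0 ≤ infDist x₀ (frontier Ω) := infDist_nonneg
  set D₀ : ℝ := wd.weight a + 10 * n ^ 2 * (1 + S) / infDist x₀ (frontier Ω) with hD₀_def
  set B : ℝ := 30 * n ^ 2 * (1 + S) * C * (60 * n * C + 1) with hB
  have hB0 : 0 ≤ B := by positivity
  have hD₀ : ∀ t, x₀ ∈ wd.cube t → ChainWeightLE wd.nbr wd.weight a t D₀ := fun t ht =>
    chainWeightLE_of_dist_le hn hΩo hS ht ha (by rw [dist_self]; positivity)
      ⟨_, ChainWeight.base, le_rfl⟩
  have hD₀0 : 0 ≤ D₀ := by positivity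
  refine ⟨a, D₀ * S + 2 * B, fun t => ?_⟩
  have hs := wd.s_pos t
  have hct := center_mem_closedCube (c := wd.c t) hs
  obtain ⟨L, hL, γ, hγ0, hγL, hγΩ, hγ, hγJ⟩ := hJ (wd.c t) (cube_subset t hct)
  rw [← hγL] at hD₀
  have hv : γ 0 ∈ wd.cube t := by rwa [hγ0]
  refine (chainWeightLE_of_john_curve hn hΩo hS hC hL hγΩ hγ hγJ hD₀ hv).mono ?_
  have h1 := half_side_le_infDist hn hv
  calc D₀ + B / infDist (γ 0) (frontier Ω) ≤ D₀ + B / (wd.s t / 2) := by gcongr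
    _ = (D₀ * wd.s t + 2 * B) / wd.s t := by field_simp
    _ ≤ (D₀ * S + 2 * B) / wd.s t := by gcongr; exact hS t

/-- A tree along which a weight comparable to the inverse side length decreases geometrically has
shadows controlled by dilated cubes. -/
lemma abs_center_sub_le_of_treeLE (T : TreeStruct wd) {D : Γ → ℕ} {M : ℝ}
    (hDw : ∀ t, wd.weight t ≤ D t) (hDM : ∀ t, (D t : ℝ) ≤ M / wd.s t)
    (hD : ∀ t, t ≠ T.root → D (T.parent t) + wd.weight t ≤ D t) (s : Γ) (k : ℕ) :
    D (T.parent^[k] s) ≤ D s ∧ ∀ i, |wd.c s i - wd.c (T.parent^[k] s) i| ≤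
      M ^ 2 / D (T.parent^[k] s) := by
  have hM : ∀ t, wd.s t ≤ M / D t := fun t => by
    have h0 := wd.s_pos t
    have h1 : 0 < (D t : ℝ) :=
      (show 0 < 1 / wd.s t by positivity).trans_le
        ((inv_le_weight t).trans (by exact_mod_cast hDw t))
    have h2 := hDM t
    rw [le_div_iff₀ h0] at h2
    rw [le_div_iff₀ h1]
    linarith
  have hDpos : ∀ t, 0 < (D t : ℝ) := fun t => by
    have h0 := wd.s_pos t
    exact (show 0 < 1 / wd.s t by positivity).trans_le
        ((inv_le_weight t).trans (by exact_mod_cast hDw t))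
  have hM0 : 0 < M := by
    have h1 := (wd.s_pos s).trans_le (hM s)
    exact (div_pos_iff_of_pos_right (hDpos s)).mp h1
  induction k with
  | zero => exact ⟨le_rfl, fun i => by simp; positivity⟩
  | succ k ih =>
    rw [Function.iterate_succ_apply']
    generalize T.parent^[k] s = t at ih
    by_cases ht : t = T.root
    · rw [ht, T.parent_root, ← ht]
      exact ih
    have h1 := hD t ht
    have h1' : (D (T.parent t) : ℝ) + wd.weight t ≤ D t := by exact_mod_cast h1
    refine ⟨by omega, fun i => ?_⟩
    have h2 := (T.parent_nbr t ht).abs_sub_le (wd.s_pos _) (wd.s_pos _) i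
    have h3 := ih.2 i
    have hP := hDpos (T.parent t)
    have hQ := hDpos t
    set P := (D (T.parent t) : ℝ)
    set Q := (D t : ℝ)
    have h4 : Q / M ≤ wd.weight t := by
      refine le_trans ?_ (inv_le_weight t)
      rw [div_le_div_iff₀ hM0 (wd.s_pos t), one_mul]
      have := hM t
      rw [le_div_iff₀ hQ] at this
      linarith
    have hPQ : P ≤ Q := by
      have : 0 ≤ Q / M := by positivity
      linarith
    have h5 : wd.s t ≤ M / P := (hM t).trans (by gcongr)
    have h6 : wd.s (T.parent t) ≤ M / P := hM _
    have h7 : M ^ 2 / Q + M / P ≤ M ^ 2 / P := by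
      rw [div_add_div _ _ hQ.ne' hP.ne', div_le_div_iff₀ (by positivity) hP]
      have : Q ≤ M * (Q - P) := by
        rw [← div_le_iff₀' hM0]
        linarith
      have h8 : M * P + Q ≤ M * Q := by linarith
      have h9 := mul_le_mul_of_nonneg_left h8 (by positivity : 0 ≤ M * P)
      nlinarith
    have h10 : |wd.c s i - wd.c (T.parent t) i| ≤
        |wd.c s i - wd.c t i| + |wd.c t i - wd.c (T.parent t) i| := abs_sub_le _ _ _
    linarith

end WhitneyDecomp

/-- on a bounded John domain, every Whitney decomposition admits a tree
structure (with some root) and a constant `K > 1` such that `Q_s ⊆ K Q_t` whenever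
`s ⪰ t`; i.e. the shadow of `Q_t` is contained in the `K`-fold dilate of `Q_t`. -/
theorem john_whitney_tree_structure
    {n : ℕ} (Ω : Set (Euc n)) (hΩo : IsOpen Ω) (hΩc : IsConnected Ω)
    (hΩb : Bornology.IsBounded Ω) (hJ : IsJohnDomain Ω)
    (Γ : Type) (wd : WhitneyDecomp n Ω Γ) :
    ∃ K : ℝ, 1 < K ∧ ∃ T : TreeStruct wd, ∀ s t : Γ, treeLE T t s →
      closedCube (wd.c s) (wd.s s) ⊆ closedCube (wd.c t) (K * wd.s t) := by
  rcases Nat.eq_zero_or_pos n with rfl | hn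
  · obtain ⟨a, -⟩ := WhitneyDecomp.exists_mem_cube (wd := wd) hΩc.nonempty.some_mem
    have : ∀ t, t = a := fun t => WhitneyDecomp.eq_of_nested (wd := wd) fun i => i.elim0
    exact ⟨2, one_lt_two, ⟨a, id, rfl, fun t => ⟨0, this t⟩, fun t ht => absurd (this t) ht⟩,
      fun _ _ _ _ _ i => i.elim0⟩
  have hS : ∀ t, wd.s t ≤ 2 * diam Ω := fun t => by
    have := half_le_diam_of_closedCube_subset hn (wd.s_pos t) hΩb (WhitneyDecomp.cube_subset t)
    linarith
  obtain ⟨a, M, hM⟩ := WhitneyDecomp.exists_root_chainWeightLE hn hΩo hJ hS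
  obtain ⟨D, parent, hroot, hDw, hpar, hDle⟩ :=
    exists_shortest_path_tree fun t => (hM t).imp fun _ h => h.1
  have hDM : ∀ t, (D t : ℝ) ≤ M / wd.s t := fun t => by
    obtain ⟨k, hk, hkM⟩ := hM t
    exact le_trans (by exact_mod_cast hDle t k hk) hkM
  have hw : ∀ t, (0 : ℝ) < wd.weight t := fun t =>
    (one_div_pos.mpr (wd.s_pos t)).trans_le (WhitneyDecomp.inv_le_weight t)
  have hreach : ∀ t, ∃ k : ℕ, parent^[k] t = a := by
    intro t
    induction hl : D t using Nat.strong_induction_on generalizing t with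
    | _ l ih =>
      by_cases ht : t = a
      · exact ⟨0, ht⟩
      · have h1 := (hpar t ht).2
        have h2 : 0 < wd.weight t := by exact_mod_cast hw t
        obtain ⟨k, hk⟩ := ih (D (parent t)) (by omega) (parent t) rfl
        exact ⟨k + 1, hk⟩
  let T : TreeStruct wd := ⟨a, parent, hroot, hreach, fun t ht => (hpar t ht).1⟩
  have hM0 : 0 < M := by
    have h1 : (0 : ℝ) < D a := (hw a).trans_le (by exact_mod_cast hDw a)
    exact (div_pos_iff_of_pos_right (wd.s_pos a)).mp (h1.trans_le (hDM a))
  refine ⟨2 * M ^ 2 + M + 2, by nlinarith, T, ?_⟩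
  rintro s _ ⟨k, rfl⟩ x hx i
  obtain ⟨h1, h2⟩ := WhitneyDecomp.abs_center_sub_le_of_treeLE T hDw hDM
    (fun t ht => (hpar t ht).2) s k
  generalize T.parent^[k] s = t at h1 h2 ⊢
  have ht := wd.s_pos t
  have hDt : 1 / wd.s t ≤ D t :=
    (WhitneyDecomp.inv_le_weight t).trans (by exact_mod_cast hDw t)
  have h3 : M ^ 2 / D t ≤ M ^ 2 * wd.s t := by
    calc M ^ 2 / D t ≤ M ^ 2 / (1 / wd.s t) := by gcongr
      _ = M ^ 2 * wd.s t := by field_simp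
  have h4 : wd.s s ≤ M * wd.s t := by
    have h5 : 1 / wd.s t ≤ M / wd.s s := hDt.trans (le_trans (by exact_mod_cast h1) (hDM s))
    rw [div_le_div_iff₀ ht (wd.s_pos s)] at h5
    linarith
  have h5 := abs_sub_le (x i) (wd.c s i) (wd.c t i)
  have h6 := hx i
  have h7 := h2 i
  nlinarith

end
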